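/- Monotonicity of the iterates: Let 0 < κ < μ < 1, ω > 0, z_a ∈ ℝ, and let F : [a,b] × ℝ → ℝ be continuous. Suppose z₀ is a lower solution and z̃₀ is an upper solution of the problem with z₀(ℓ) ≤ z̃₀(ℓ) for all ℓ ∈ [a,b], and that F(ℓ,x) ≤ F(ℓ,y) whenever z₀(ℓ) ≤ x ≤ y ≤ z̃₀(ℓ). Define recursively z_{n+1}(ℓ) = z_a + ∫_a^ℓ Φ'(ρ)(Φ(ℓ)−Φ(ρ))^{μ−1} E_{μ−κ,μ}(−ω(Φ(ℓ)−Φ(ρ))^{μ−κ}) F(ρ, z_n(ρ)) dρ and z̃_{n+1}(ℓ) = z_a + ∫_a^ℓ Φ'(ρ)(Φ(ℓ)−Φ(ρ))^{μ−1} E_{μ−κ,μ}(−ω(Φ(ℓ)−Φ(ρ))^{μ−κ}) F(ρ, z̃_n(ρ)) dρ. Then for every n ≥ 0 and every ℓ ∈ [a,b]: z_n(ℓ) ≤ z_{n+1}(ℓ) ≤ z̃_{n+1}(ℓ) ≤ z̃_n(ℓ). -/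

import Mathlib

open Real MeasureTheory Set

/-- Two-parameter Mittag-Leffler function `E_{p,q}(x) = ∑_{k=0}^∞ x^k / Γ(pk+q)`. -/
noncomputable def mittagLeffler (p q x : ℝ) : ℝ :=
  ∑' k : ℕ, x ^ k / Real.Gamma (p * k + q)

theorem rpow_mul_exp_neg_le_Gamma {R x : ℝ} (hR : 0 < R) (hx : 1 ≤ x) :
    R ^ (x - 1) * exp (-R) ≤ Real.Gamma x := by
  rw [Real.Gamma_eq_integral (by linarith)]
  have hint := Real.GammaIntegral_convergent (s := x) (by linarith)
  calc R ^ (x - 1) * exp (-R) = ∫ t in Ioi R, R ^ (x - 1) * exp (-t) := by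
        rw [integral_const_mul, integral_exp_neg_Ioi]
    _ ≤ ∫ t in Ioi R, exp (-t) * t ^ (x - 1) := by
        refine setIntegral_mono_on ((integrableOn_exp_neg_Ioi R).const_mul _)
          (hint.mono_set (Ioi_subset_Ioi hR.le)) measurableSet_Ioi fun t ht ↦ ?_
        rw [mul_comm]
        have := Real.rpow_le_rpow hR.le (le_of_lt ht) (by linarith : 0 ≤ x - 1)
        gcongr
    _ ≤ ∫ t in Ioi 0, exp (-t) * t ^ (x - 1) := by
        refine setIntegral_mono_set hint ?_ (Ioi_subset_Ioi hR.le).eventuallyLE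
        filter_upwards [ae_restrict_mem measurableSet_Ioi] with t ht
        have : (0 : ℝ) < t := ht
        simp only [Pi.zero_apply]
        positivity

theorem summable_mittagLeffler {p q : ℝ} (hp : 0 < p) (hq : 0 < q) (x : ℝ) :
    Summable fun k : ℕ ↦ x ^ k / Real.Gamma (p * k + q) := by
  set y := |x| + 1 with hy
  have hy0 : 0 < y := by positivity
  set R := (2 * y) ^ p⁻¹ with hR
  have hR0 : 0 < R := by positivity
  have hRp : R ^ p = 2 * y := by
    rw [hR, ← Real.rpow_mul (by positivity), inv_mul_cancel₀ hp.ne', Real.rpow_one]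
  refine Summable.of_norm_bounded_eventually_nat
    (g := fun k ↦ (R ^ (q - 1) * exp (-R))⁻¹ * (1 / 2) ^ k)
    ((summable_geometric_of_lt_one (by norm_num) (by norm_num)).mul_left _) ?_
  obtain ⟨N, hN⟩ := exists_nat_ge (1 / p)
  filter_upwards [Filter.eventually_ge_atTop N] with k hk
  have hk' : 1 / p ≤ k := hN.trans (by exact_mod_cast hk)
  have h1 : 1 ≤ p * k + q := by
    rw [div_le_iff₀ hp] at hk'
    linarith
  have hG := rpow_mul_exp_neg_le_Gamma hR0 h1
  have e : R ^ (p * k + q - 1) = (2 * y) ^ k * R ^ (q - 1) := by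
    rw [add_sub_assoc, Real.rpow_add hR0, Real.rpow_mul hR0.le, hRp, Real.rpow_natCast]
  rw [e] at hG
  have hxy : |x| ≤ y := by rw [hy]; linarith
  rw [norm_div, norm_pow, Real.norm_eq_abs, Real.norm_eq_abs,
    abs_of_pos (lt_of_lt_of_le (by positivity) hG)]
  calc |x| ^ k / Real.Gamma (p * k + q) ≤ y ^ k / ((2 * y) ^ k * R ^ (q - 1) * exp (-R)) := by
        gcongr
    _ = _ := by
        rw [mul_pow, div_pow, one_pow]
        field_simp

theorem differentiable_mittagLeffler {p q : ℝ} (hp : 0 < p) (hq : 0 < q) :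
    Differentiable ℝ (mittagLeffler p q) := by
  set P := FormalMultilinearSeries.ofScalars ℝ (fun k : ℕ ↦ (Real.Gamma (p * k + q))⁻¹) with hP
  have hrad : P.radius = ⊤ := by
    refine P.radius_eq_top_of_summable_norm fun r ↦ ?_
    refine (summable_mittagLeffler hp hq r).abs.of_nonneg_of_le (fun _ ↦ by positivity) fun k ↦ ?_
    rw [hP, FormalMultilinearSeries.ofScalars_norm, abs_div, abs_pow, norm_inv,
      Real.norm_eq_abs, NNReal.abs_eq, div_eq_inv_mul]
  have hsum : P.sum = mittagLeffler p q := by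
    ext x
    refine (FormalMultilinearSeries.ofScalars_sum_eq _ x).trans ?_
    simp only [mittagLeffler, smul_eq_mul, div_eq_inv_mul]
  have hps := P.hasFPowerSeriesOnBall (by simp [hrad])
  rw [hsum, hrad] at hps
  intro x
  exact (hps.analyticAt_of_mem (by simp)).differentiableAt

/-- The Beta integral on `(0, u)` in terms of the Gamma function. -/
theorem setIntegral_rpow_mul_rpow {p q u : ℝ} (hp : 0 < p) (hq : 0 < q) (hu : 0 < u) :
    ∫ y in Ioo 0 u, (u - y) ^ (p - 1) * y ^ (q - 1) =
      Real.Gamma p * Real.Gamma q / Real.Gamma (p + q) * u ^ (p + q - 1) := by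
  have h := Complex.betaIntegral_scaled q p hu
  rw [Complex.betaIntegral_eq_Gamma_mul_div _ _ (by simpa) (by simpa),
    intervalIntegral.integral_of_le hu.le, integral_Ioc_eq_integral_Ioo] at h
  have e : ∫ y in Ioo 0 u, (y : ℂ) ^ ((q : ℂ) - 1) * ((u : ℂ) - y) ^ ((p : ℂ) - 1) =
      ((∫ y in Ioo 0 u, (u - y) ^ (p - 1) * y ^ (q - 1) : ℝ) : ℂ) := by
    rw [← integral_complex_ofReal]
    refine setIntegral_congr_fun measurableSet_Ioo fun y hy ↦ ?_
    simp only [Complex.ofReal_mul]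
    rw [Complex.ofReal_cpow (by linarith [hy.2]), Complex.ofReal_cpow hy.1.le, mul_comm]
    push_cast
    rfl
  rw [e, ← Complex.ofReal_add, Complex.Gamma_ofReal, Complex.Gamma_ofReal, Complex.Gamma_ofReal,
    ← Complex.ofReal_one, ← Complex.ofReal_sub, ← Complex.ofReal_cpow hu.le] at h
  have h' := Complex.ofReal_injective (h.trans (by push_cast; rfl : _ =
    ((u ^ (q + p - 1) * (Real.Gamma q * Real.Gamma p / Real.Gamma (q + p)) : ℝ) : ℂ)))
  rw [h', add_comm q p]
  ring

theorem integrableOn_rpow_mul_rpow {p q u : ℝ} (hp : 0 < p) (hq : 0 < q) (hu : 0 < u) :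
    IntegrableOn (fun y ↦ (u - y) ^ (p - 1) * y ^ (q - 1)) (Ioo 0 u) := by
  refine Integrable.of_integral_ne_zero ?_
  rw [setIntegral_rpow_mul_rpow hp hq hu]
  have := Real.Gamma_pos_of_pos hp
  have := Real.Gamma_pos_of_pos hq
  have := Real.Gamma_pos_of_pos (add_pos hp hq)
  positivity

theorem mittagLeffler_one_eq {p : ℝ} (hp : 0 < p) (x : ℝ) :
    mittagLeffler p 1 x = 1 + x * mittagLeffler p (1 + p) x := by
  unfold mittagLeffler
  rw [(summable_mittagLeffler hp one_pos x).tsum_eq_zero_add, ← tsum_mul_left]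
  congr 1
  · simp
  · refine tsum_congr fun k ↦ ?_
    rw [pow_succ']
    push_cast
    rw [show p * ((k : ℝ) + 1) + 1 = p * k + (1 + p) by ring, mul_div_assoc]

/-- The kernel `u ^ (q - 1) * E_{p,q}(c * u ^ p)`. -/
noncomputable def mittagLefflerKernel (p q c u : ℝ) : ℝ :=
  u ^ (q - 1) * mittagLeffler p q (c * u ^ p)

theorem measurable_mittagLefflerKernel {p q : ℝ} (hp : 0 < p) (hq : 0 < q) (c : ℝ) :
    Measurable (mittagLefflerKernel p q c) := by
  unfold mittagLefflerKernel
  have := (differentiable_mittagLeffler hp hq).continuous.measurable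
  fun_prop

theorem differentiableAt_mittagLefflerKernel {p q c u : ℝ} (hp : 0 < p) (hq : 0 < q)
    (hu : 0 < u) : DifferentiableAt ℝ (mittagLefflerKernel p q c) u := by
  unfold mittagLefflerKernel
  refine (differentiableAt_id.rpow_const (Or.inl hu.ne')).mul ?_
  exact (differentiable_mittagLeffler hp hq).differentiableAt.comp u
    ((differentiableAt_id.rpow_const (Or.inl hu.ne')).const_mul c)

theorem continuous_mittagLeffler_rpow {p q : ℝ} (hp : 0 < p) (hq : 0 < q) (c : ℝ) :
    Continuous fun u : ℝ ↦ mittagLeffler p q (c * u ^ p) :=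
  (differentiable_mittagLeffler hp hq).continuous.comp
    (continuous_const.mul (Real.continuous_rpow_const hp.le))

theorem integrableOn_mittagLefflerKernel {p q : ℝ} (hp : 0 < p) (hq : 0 < q) (c U : ℝ) :
    IntegrableOn (mittagLefflerKernel p q c) (Ioo 0 U) := by
  rcases le_or_gt U 0 with hU | hU
  · simp [Ioo_eq_empty_of_le hU]
  have h := (intervalIntegral.intervalIntegrable_rpow' (a := 0) (b := U)
    (show -1 < q - 1 by linarith)).mul_continuousOn
      (continuous_mittagLeffler_rpow hp hq c).continuousOn
  rwa [intervalIntegrable_iff_integrableOn_Ioo_of_le hU.le] at h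

theorem integrableOn_mittagLefflerKernel_mul_rpow {p q r U : ℝ} (hp : 0 < p) (hq : 0 < q)
    (hr : 0 < r) (hU : 0 < U) (c : ℝ) :
    IntegrableOn (fun y ↦ mittagLefflerKernel p q c (U - y) * y ^ (r - 1)) (Ioo 0 U) := by
  have h := integrableOn_rpow_mul_rpow hq hr hU
  rw [← integrableOn_Icc_iff_integrableOn_Ioo] at h ⊢
  refine (h.mul_continuousOn ((continuous_mittagLeffler_rpow hp hq c).comp
    (continuous_const.sub continuous_id : Continuous fun y ↦ U - y)).continuousOn
    isCompact_Icc).congr_fun (fun y _ ↦ ?_) measurableSet_Icc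
  simp only [mittagLefflerKernel, Function.comp_apply, Pi.sub_apply]
  ring

/-- The Riemann–Liouville integral of a Mittag-Leffler kernel is a Mittag-Leffler kernel. -/
theorem setIntegral_mittagLefflerKernel_mul_rpow {p q r U : ℝ} (hp : 0 < p) (hq : 0 < q)
    (hr : 0 < r) (hU : 0 < U) (c : ℝ) :
    ∫ y in Ioo 0 U, mittagLefflerKernel p q c (U - y) * y ^ (r - 1) =
      Real.Gamma r * mittagLefflerKernel p (q + r) c U := by
  have hq' (n : ℕ) : 0 < p * n + q := by positivity
  have hΓr := Real.Gamma_pos_of_pos hr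
  set f : ℕ → ℝ → ℝ := fun n y ↦ c ^ n / Real.Gamma (p * n + q) *
    ((U - y) ^ (p * n + q - 1) * y ^ (r - 1)) with hf
  have hint (n : ℕ) : ∫ y in Ioo 0 U, f n y = Real.Gamma r * U ^ (q + r - 1) *
      ((c * U ^ p) ^ n / Real.Gamma (p * n + (q + r))) := by
    rw [hf, integral_const_mul, setIntegral_rpow_mul_rpow (hq' n) hr hU]
    have := (Real.Gamma_pos_of_pos (hq' n)).ne'
    rw [show p * n + q + r - 1 = p * n + (q + r - 1) by ring, Real.rpow_add hU,
      Real.rpow_mul hU.le, Real.rpow_natCast, mul_pow, add_assoc]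
    field_simp
  have hnorm (n : ℕ) : ∫ y in Ioo 0 U, ‖f n y‖ = |∫ y in Ioo 0 U, f n y| := by
    have e : ∀ y ∈ Ioo 0 U, ‖f n y‖ = |c ^ n / Real.Gamma (p * n + q)| *
        ((U - y) ^ (p * n + q - 1) * y ^ (r - 1)) := fun y hy ↦ by
      have : 0 ≤ U - y := by linarith [hy.2]
      have := hy.1.le
      rw [hf, norm_mul, Real.norm_eq_abs, Real.norm_of_nonneg (by positivity)]
    have hnn : 0 ≤ ∫ y in Ioo 0 U, (U - y) ^ (p * n + q - 1) * y ^ (r - 1) :=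
      setIntegral_nonneg measurableSet_Ioo fun y hy ↦ by
        have : 0 ≤ U - y := by linarith [hy.2]
        have := hy.1.le
        positivity
    rw [setIntegral_congr_fun measurableSet_Ioo e, hf, integral_const_mul, integral_const_mul,
      abs_mul, abs_of_nonneg hnn]
  have hsum : Summable fun n ↦ ∫ y in Ioo 0 U, f n y := by
    simp_rw [hint]
    exact (summable_mittagLeffler hp (add_pos hq hr) _).mul_left _
  have key := hasSum_integral_of_summable_integral_norm (F := f)
    (fun n ↦ (integrableOn_rpow_mul_rpow (hq' n) hr hU).const_mul _)
    (by simp_rw [hnorm]; exact hsum.abs)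
  have e : ∀ y ∈ Ioo 0 U, ∑' n, f n y = mittagLefflerKernel p q c (U - y) * y ^ (r - 1) := by
    intro y hy
    have hy' : 0 < U - y := by linarith [hy.2]
    rw [mittagLefflerKernel, mittagLeffler, ← tsum_mul_left, ← tsum_mul_right]
    refine tsum_congr fun n ↦ ?_
    rw [hf]
    simp only
    rw [add_sub_assoc, Real.rpow_add hy', Real.rpow_mul hy'.le, Real.rpow_natCast, mul_pow]
    ring
  rw [← setIntegral_congr_fun measurableSet_Ioo e, ← key.tsum_eq]
  simp_rw [hint]
  rw [tsum_mul_left, mittagLefflerKernel, mittagLeffler, mul_assoc]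

/-- The memory kernel `u ^ (-μ) / Γ(1 - μ) + ω * u ^ (-κ) / Γ(1 - κ)` of the operator
`D^μ + ω D^κ`. -/
noncomputable def memoryKernel (μ κ ω u : ℝ) : ℝ :=
  1 / Real.Gamma (1 - μ) * u ^ (-μ) + ω * (1 / Real.Gamma (1 - κ) * u ^ (-κ))

theorem integrableOn_mittagLefflerKernel_mul_memoryKernel {μ κ U : ℝ} (hκ : 0 < κ) (hκμ : κ < μ)
    (hμ : μ < 1) (ω : ℝ) (hU : 0 < U) :
    IntegrableOn (fun y ↦ mittagLefflerKernel (μ - κ) μ (-ω) (U - y) * memoryKernel μ κ ω y)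
      (Ioo 0 U) := by
  have h (r : ℝ) (hr : r < 1) := integrableOn_mittagLefflerKernel_mul_rpow (sub_pos.2 hκμ)
    (hκ.trans hκμ) (sub_pos.2 hr) hU (-ω)
  have h1 := ((h μ hμ).const_mul (1 / Real.Gamma (1 - μ))).add
    ((h κ (hκμ.trans hμ)).const_mul (ω * (1 / Real.Gamma (1 - κ))))
  refine h1.congr (Filter.Eventually.of_forall fun y ↦ ?_)
  simp only [memoryKernel, Pi.add_apply, sub_sub_cancel_left]
  ring

/-- The Mittag-Leffler kernel is the Sonine conjugate of the memory kernel. -/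
theorem setIntegral_mittagLefflerKernel_mul_memoryKernel {μ κ U : ℝ} (hκ : 0 < κ) (hκμ : κ < μ)
    (hμ : μ < 1) (ω : ℝ) (hU : 0 < U) :
    ∫ y in Ioo 0 U, mittagLefflerKernel (μ - κ) μ (-ω) (U - y) * memoryKernel μ κ ω y = 1 := by
  have hκ1 := hκμ.trans hμ
  have hi (r : ℝ) (hr : r < 1) := integrableOn_mittagLefflerKernel_mul_rpow (sub_pos.2 hκμ)
    (hκ.trans hκμ) (sub_pos.2 hr) hU (-ω)
  have h (r : ℝ) (hr : r < 1) := setIntegral_mittagLefflerKernel_mul_rpow (sub_pos.2 hκμ)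
    (hκ.trans hκμ) (sub_pos.2 hr) hU (-ω)
  have e (y : ℝ) : mittagLefflerKernel (μ - κ) μ (-ω) (U - y) * memoryKernel μ κ ω y =
      1 / Real.Gamma (1 - μ) * (mittagLefflerKernel (μ - κ) μ (-ω) (U - y) * y ^ (1 - μ - 1)) +
      ω * (1 / Real.Gamma (1 - κ)) *
        (mittagLefflerKernel (μ - κ) μ (-ω) (U - y) * y ^ (1 - κ - 1)) := by
    simp only [memoryKernel, sub_sub_cancel_left]
    ring
  simp_rw [e]
  rw [integral_add ((hi μ hμ).const_mul _) ((hi κ hκ1).const_mul _), integral_const_mul,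
    integral_const_mul, h μ hμ, h κ hκ1]
  have h1 := (Real.Gamma_pos_of_pos (sub_pos.2 hμ)).ne'
  have h2 := (Real.Gamma_pos_of_pos (sub_pos.2 hκ1)).ne'
  have e1 : μ + (1 - μ) = 1 := by ring
  have e2 : μ + (1 - κ) = 1 + (μ - κ) := by ring
  rw [e1, e2, mittagLefflerKernel, mittagLefflerKernel, mittagLeffler_one_eq (sub_pos.2 hκμ),
    sub_self, Real.rpow_zero, add_sub_cancel_left]
  field_simp
  ring

theorem intervalIntegrable_mittagLefflerKernel_mul_memoryKernel {μ κ U : ℝ} (hκ : 0 < κ)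
    (hκμ : κ < μ) (hμ : μ < 1) (ω : ℝ) (hU : 0 < U) :
    IntervalIntegrable
      (fun s ↦ mittagLefflerKernel (μ - κ) μ (-ω) s * memoryKernel μ κ ω (U - s)) volume 0 U := by
  have h := integrableOn_mittagLefflerKernel_mul_memoryKernel hκ hκμ hμ ω hU
  rw [← intervalIntegrable_iff_integrableOn_Ioo_of_le hU.le] at h
  simpa using (h.comp_sub_left U).symm

theorem integral_mittagLefflerKernel_mul_memoryKernel {μ κ U : ℝ} (hκ : 0 < κ) (hκμ : κ < μ)
    (hμ : μ < 1) (ω : ℝ) (hU : 0 < U) :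
    ∫ s in 0..U, mittagLefflerKernel (μ - κ) μ (-ω) s * memoryKernel μ κ ω (U - s) = 1 := by
  have h := intervalIntegral.integral_comp_sub_left (a := 0) (b := U)
    (fun y ↦ mittagLefflerKernel (μ - κ) μ (-ω) (U - y) * memoryKernel μ κ ω y) U
  simp only [sub_sub_cancel, sub_self, sub_zero] at h
  rw [h, intervalIntegral.integral_of_le hU.le, integral_Ioc_eq_integral_Ioo,
    setIntegral_mittagLefflerKernel_mul_memoryKernel hκ hκμ hμ ω hU]

theorem mul_sub_le_rpow_neg_sub_rpow_neg {p x y : ℝ} (hp : 0 ≤ p) (hx : 0 < x) (hxy : x ≤ y) :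
    p * y ^ (-p - 1) * (y - x) ≤ x ^ (-p) - y ^ (-p) := by
  have hy : 0 < y := hx.trans_le hxy
  have h1 : 1 - x / y ≤ Real.log (y / x) := by
    simpa using Real.one_sub_inv_le_log_of_pos (div_pos hy hx)
  have h2 : 1 + p * (1 - x / y) ≤ (y / x) ^ p := by
    rw [Real.rpow_def_of_pos (div_pos hy hx)]
    have := Real.add_one_le_exp (Real.log (y / x) * p)
    nlinarith
  have h3 : x ^ (-p) = y ^ (-p) * (y / x) ^ p := by
    rw [Real.div_rpow hy.le hx.le, Real.rpow_neg hy.le, Real.rpow_neg hx.le]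
    have := (Real.rpow_pos_of_pos hy p).ne'
    field_simp
  have h4 := mul_le_mul_of_nonneg_left h2 (Real.rpow_nonneg hy.le (-p))
  rw [h3, Real.rpow_sub_one hy.ne']
  have : p * (y ^ (-p) / y) * (y - x) = y ^ (-p) * (p * (1 - x / y)) := by field_simp
  linarith

section

variable {μ κ ω : ℝ}

theorem memoryKernel_nonneg (hκ : κ < 1) (hμ : μ < 1) (hω : 0 ≤ ω) {u : ℝ} (hu : 0 ≤ u) :
    0 ≤ memoryKernel μ κ ω u := by
  have := Real.Gamma_pos_of_pos (sub_pos.2 hμ)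
  have := Real.Gamma_pos_of_pos (sub_pos.2 hκ)
  unfold memoryKernel
  positivity

theorem mul_sub_le_memoryKernel_sub (hκ0 : 0 ≤ κ) (hκ : κ < 1) (hμ0 : 0 ≤ μ) (hμ : μ < 1)
    (hω : 0 ≤ ω) {x y : ℝ} (hx : 0 < x) (hxy : x ≤ y) :
    1 / Real.Gamma (1 - μ) * (μ * y ^ (-μ - 1)) * (y - x) ≤
      memoryKernel μ κ ω x - memoryKernel μ κ ω y := by
  have h1 := Real.Gamma_pos_of_pos (sub_pos.2 hμ)
  have h2 := Real.Gamma_pos_of_pos (sub_pos.2 hκ)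
  have h3 := mul_sub_le_rpow_neg_sub_rpow_neg hμ0 hx hxy
  have h4 : 0 ≤ x ^ (-κ) - y ^ (-κ) := le_trans (by
    have := hx.trans_le hxy
    have := sub_nonneg.2 hxy
    positivity) (mul_sub_le_rpow_neg_sub_rpow_neg hκ0 hx hxy)
  have h5 := mul_le_mul_of_nonneg_left h3 (one_div_pos.2 h1).le
  have h6 : 0 ≤ ω * (1 / Real.Gamma (1 - κ)) * (x ^ (-κ) - y ^ (-κ)) := by positivity
  unfold memoryKernel
  linarith

theorem tendsto_mul_memoryKernel (hκ : κ < 1) (hμ : μ < 1) :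
    Filter.Tendsto (fun u ↦ u * memoryKernel μ κ ω u) (nhdsWithin 0 (Ioi 0)) (nhds 0) := by
  have hc : Continuous fun u : ℝ ↦ 1 / Real.Gamma (1 - μ) * u ^ (1 - μ) +
      ω * (1 / Real.Gamma (1 - κ) * u ^ (1 - κ)) :=
    (continuous_const.mul (Real.continuous_rpow_const (sub_pos.2 hμ).le)).add
      (continuous_const.mul (continuous_const.mul (Real.continuous_rpow_const (sub_pos.2 hκ).le)))
  have h := (hc.tendsto 0).mono_left (nhdsWithin_le_nhds (s := Ioi 0))
  rw [Real.zero_rpow (sub_pos.2 hμ).ne', Real.zero_rpow (sub_pos.2 hκ).ne'] at h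
  simp only [mul_zero, add_zero] at h
  refine h.congr' ?_
  filter_upwards [self_mem_nhdsWithin] with u hu
  have hu : 0 < u := hu
  rw [memoryKernel, sub_eq_add_neg 1 μ, sub_eq_add_neg 1 κ, Real.rpow_add hu, Real.rpow_add hu,
    Real.rpow_one]
  ring

theorem eventually_mittagLefflerKernel_pos {p q c : ℝ} (hp : 0 < p) (hq : 0 < q) :
    ∀ᶠ u in nhdsWithin 0 (Ioi 0), 0 < mittagLefflerKernel p q c u := by
  have h0 : 0 < mittagLeffler p q (c * 0 ^ p) := by
    have e : mittagLeffler p q 0 = 1 / Real.Gamma q := by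
      rw [mittagLeffler, tsum_eq_single 0 fun k hk ↦ by simp [hk]]
      simp
    rw [Real.zero_rpow hp.ne', mul_zero, e]
    exact one_div_pos.2 (Real.Gamma_pos_of_pos hq)
  have h := ((continuous_mittagLeffler_rpow hp hq c).tendsto 0).mono_left
    (nhdsWithin_le_nhds (s := Ioi 0))
  filter_upwards [h.eventually (lt_mem_nhds h0), self_mem_nhdsWithin] with u hu hu0
  exact mul_pos (Real.rpow_pos_of_pos hu0 _) hu

/-- A function that is positive near `0` and has no first zero is positive. -/
theorem pos_of_forall_first_nonpos {k : ℝ → ℝ} (hc : ∀ u, 0 < u → ContinuousAt k u)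
    (h0 : ∀ᶠ u in nhdsWithin 0 (Ioi 0), 0 < k u)
    (h : ∀ u, 0 < u → (∀ s, 0 < s → s < u → 0 < k s) → 0 < k u) {u : ℝ} (hu : 0 < u) :
    0 < k u := by
  by_contra! hku
  obtain ⟨δ, hδ, hδk⟩ := mem_nhdsGT_iff_exists_Ioo_subset.1 h0
  have hδ : 0 < δ := hδ
  have hδu : δ ≤ u := by
    by_contra! hlt
    exact absurd (hδk ⟨hu, hlt⟩ : 0 < k u) hku.not_gt
  have hcl : IsClosed (Icc (δ / 2) u ∩ k ⁻¹' Iic 0) :=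
    ContinuousOn.preimage_isClosed_of_isClosed
      (fun x hx ↦ (hc x (by linarith [hx.1])).continuousWithinAt) isClosed_Icc isClosed_Iic
  obtain ⟨v, ⟨hv, hkv⟩, hleast⟩ := (isCompact_Icc.of_isClosed_subset hcl
    inter_subset_left).exists_isLeast ⟨u, ⟨by linarith, le_rfl⟩, hku⟩
  refine (h v (by linarith [hv.1]) fun s hs hsv ↦ ?_).not_ge hkv
  by_contra! hks
  rcases lt_or_ge s δ with hsδ | hsδ
  · exact absurd (hδk ⟨hs, hsδ⟩ : 0 < k s) hks.not_gt
  · exact hsv.not_ge (hleast ⟨⟨by linarith, by linarith [hv.2]⟩, hks⟩)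

theorem mittagLefflerKernel_pos (hκ : 0 < κ) (hκμ : κ < μ) (hμ : μ < 1) (hω : 0 ≤ ω) {u : ℝ}
    (hu : 0 < u) : 0 < mittagLefflerKernel (μ - κ) μ (-ω) u := by
  have hα := sub_pos.2 hκμ
  have hμ0 := hκ.trans hκμ
  have hκ1 := hκμ.trans hμ
  set k := mittagLefflerKernel (μ - κ) μ (-ω) with hk
  set G := memoryKernel μ κ ω with hG
  refine pos_of_forall_first_nonpos
    (fun u hu ↦ (differentiableAt_mittagLefflerKernel hα hμ0 hu).continuousAt)
    (eventually_mittagLefflerKernel_pos hα hμ0) (fun v hv hpos ↦ ?_) hu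
  by_contra! hkv
  obtain ⟨L, hL, hLk⟩ := (differentiableAt_mittagLefflerKernel (c := -ω) hα hμ0
    hv).isBigO_sub.exists_pos
  rw [Asymptotics.isBigOWith_iff, Metric.eventually_nhds_iff] at hLk
  obtain ⟨ε, hε, hLk⟩ := hLk
  have hkint (s t : ℝ) (hs : 0 ≤ s) (hst : s ≤ t) : IntervalIntegrable k volume s t := by
    rw [intervalIntegrable_iff_integrableOn_Ioo_of_le hst]
    exact (integrableOn_mittagLefflerKernel hα hμ0 _ t).mono_set (Ioo_subset_Ioo_left hs)
  set I := ∫ s in 0..v / 2, k s with hI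
  have hI0 : 0 < I := intervalIntegral.intervalIntegral_pos_of_pos_on
    (hkint 0 (v / 2) le_rfl (by linarith)) (fun s hs ↦ hpos s hs.1 (by linarith [hs.2]))
    (by linarith)
  set c := 1 / Real.Gamma (1 - μ) * (μ * v ^ (-μ - 1)) with hc
  have hc0 : 0 < c := by
    have := Real.Gamma_pos_of_pos (sub_pos.2 hμ)
    positivity
  have hev : ∀ᶠ x in nhdsWithin 0 (Ioi 0), x * G x < c * I / 2 / L :=
    (tendsto_mul_memoryKernel hκ1 hμ).eventually (gt_mem_nhds (by positivity))
  obtain ⟨η, hη, hηG⟩ := mem_nhdsGT_iff_exists_Ioo_subset.1 hev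
  have hη : 0 < η := hη
  set h := min (min η ε) v / 2 with hh
  have hh0 : 0 < h := by positivity
  have hhη : h < η := by
    have := (min_le_left (min η ε) v).trans (min_le_left η ε)
    linarith
  have hhε : h < ε := by
    have := (min_le_left (min η ε) v).trans (min_le_right η ε)
    linarith
  have hhv : h ≤ v / 2 := by
    have := min_le_right (min η ε) v
    linarith
  set t := v - h with ht
  have ht0 : 0 < t := by linarith
  have hit := intervalIntegrable_mittagLefflerKernel_mul_memoryKernel hκ hκμ hμ ω ht0
  have hiv := intervalIntegrable_mittagLefflerKernel_mul_memoryKernel hκ hκμ hμ ω hv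
  rw [← hk, ← hG] at hit hiv
  have hiv1 : IntervalIntegrable (fun s ↦ k s * G (v - s)) volume 0 t :=
    hiv.mono_set (by
      rw [uIcc_of_le ht0.le, uIcc_of_le hv.le]
      exact Icc_subset_Icc_right (by linarith))
  have hiv2 : IntervalIntegrable (fun s ↦ k s * G (v - s)) volume t v :=
    hiv.mono_set (by
      rw [uIcc_of_le (by linarith), uIcc_of_le hv.le]; exact Icc_subset_Icc_left ht0.le)
  have e1 := integral_mittagLefflerKernel_mul_memoryKernel hκ hκμ hμ ω ht0
  have e2 := integral_mittagLefflerKernel_mul_memoryKernel hκ hκμ hμ ω hv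
  rw [← hk, ← hG] at e1 e2
  rw [← intervalIntegral.integral_add_adjacent_intervals hiv1 hiv2] at e2
  have hdiff := intervalIntegral.integral_sub hit hiv1
  have hlow : c * h * I ≤ ∫ s in 0..t, (k s * G (t - s) - k s * G (v - s)) := by
    have hb (s : ℝ) (hs : s ∈ Ioo 0 t) :
        c * h * k s ≤ k s * G (t - s) - k s * G (v - s) := by
      have hks := hpos s hs.1 (by linarith [hs.2])
      have hG' := mul_sub_le_memoryKernel_sub hκ.le hκ1 hμ0.le hμ hω
        (show 0 < t - s by linarith [hs.2]) (show t - s ≤ v - s by linarith)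
      have hmono : v ^ (-μ - 1) ≤ (v - s) ^ (-μ - 1) :=
        Real.rpow_le_rpow_of_nonpos (by linarith [hs.2]) (by linarith [hs.1]) (by linarith)
      have : c * h ≤ G (t - s) - G (v - s) := by
        refine le_trans ?_ hG'
        have := Real.Gamma_pos_of_pos (sub_pos.2 hμ)
        rw [hc, show v - s - (t - s) = h by rw [ht]; ring]
        gcongr
      nlinarith
    calc c * h * I ≤ c * h * ∫ s in 0..t, k s := by
          refine mul_le_mul_of_nonneg_left ?_ (by positivity)
          rw [hI]
          refine intervalIntegral.integral_mono_interval le_rfl (by linarith) (by linarith) ?_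
            (hkint 0 t le_rfl ht0.le)
          filter_upwards [ae_restrict_mem measurableSet_Ioc] with s hs
          exact (hpos s hs.1 (by linarith [hs.2])).le
      _ = ∫ s in 0..t, c * h * k s := (intervalIntegral.integral_const_mul _ _).symm
      _ ≤ _ := intervalIntegral.integral_mono_on_of_le_Ioo ht0.le
          ((hkint 0 t le_rfl ht0.le).const_mul _) (hit.sub hiv1) hb
  have hup : ∫ s in t..v, k s * G (v - s) ≤ h * (c * I / 2) := by
    have hb (s : ℝ) (hs : s ∈ Ioo t v) : k s * G (v - s) ≤ c * I / 2 := by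
      have hvs : 0 < v - s := by linarith [hs.2]
      have h1 := hLk (y := s) (by
        rw [Real.dist_eq, abs_sub_comm, abs_of_pos hvs]
        linarith [hs.1])
      rw [Real.norm_eq_abs, Real.norm_eq_abs, abs_sub_comm s, abs_of_pos hvs] at h1
      have h2 : k s ≤ L * (v - s) := by
        have := (le_abs_self _).trans h1
        linarith
      have h3 : (v - s) * G (v - s) < c * I / 2 / L := hηG ⟨hvs, by linarith [hs.1]⟩
      rw [lt_div_iff₀ hL] at h3
      have h4 := mul_le_mul_of_nonneg_right h2 (memoryKernel_nonneg hκ1 hμ hω hvs.le)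
      rw [← hG] at h4
      linarith
    have := intervalIntegral.integral_mono_on_of_le_Ioo (by linarith) hiv2
      (intervalIntegrable_const (c := c * I / 2)) hb
    rw [intervalIntegral.integral_const, smul_eq_mul] at this
    rwa [show v - t = h by rw [ht]; ring] at this
  have : 0 < h * (c * I) := by positivity
  linarith

end

section ChangeOfVariables

variable {Φ Φ' : ℝ → ℝ} {s t : ℝ}

theorem strictMonoOn_of_forall_hasDerivAt_pos (hd : ∀ x ∈ Icc s t, HasDerivAt Φ (Φ' x) x)
    (hpos : ∀ x ∈ Icc s t, 0 < Φ' x) : StrictMonoOn Φ (Icc s t) :=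
  strictMonoOn_of_hasDerivWithinAt_pos (convex_Icc s t)
    (fun x hx ↦ (hd x hx).continuousAt.continuousWithinAt)
    (fun x hx ↦ (hd x (interior_subset hx)).hasDerivWithinAt)
    (fun x hx ↦ hpos x (interior_subset hx))

theorem image_Ioo_of_forall_hasDerivAt_pos (hst : s ≤ t)
    (hd : ∀ x ∈ Icc s t, HasDerivAt Φ (Φ' x) x) (hpos : ∀ x ∈ Icc s t, 0 < Φ' x) :
    Φ '' Ioo s t = Ioo (Φ s) (Φ t) :=
  (strictMonoOn_of_forall_hasDerivAt_pos hd hpos).image_Ioo_subset.antisymm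
    (intermediate_value_Ioo hst fun x hx ↦ (hd x hx).continuousAt.continuousWithinAt)

theorem integrableOn_deriv_mul_comp_iff (hst : s ≤ t)
    (hd : ∀ x ∈ Icc s t, HasDerivAt Φ (Φ' x) x) (hpos : ∀ x ∈ Icc s t, 0 < Φ' x) (f : ℝ → ℝ) :
    IntegrableOn (fun x ↦ Φ' x * f (Φ x)) (Ioo s t) ↔ IntegrableOn f (Ioo (Φ s) (Φ t)) := by
  rw [← image_Ioo_of_forall_hasDerivAt_pos hst hd hpos,
    integrableOn_image_iff_integrableOn_abs_deriv_smul measurableSet_Ioo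
      (fun x hx ↦ (hd x (Ioo_subset_Icc_self hx)).hasDerivWithinAt)
      ((strictMonoOn_of_forall_hasDerivAt_pos hd hpos).injOn.mono Ioo_subset_Icc_self)]
  refine integrableOn_congr_fun (fun x hx ↦ ?_) measurableSet_Ioo
  rw [abs_of_pos (hpos x (Ioo_subset_Icc_self hx)), smul_eq_mul]

theorem setIntegral_deriv_mul_comp (hst : s ≤ t)
    (hd : ∀ x ∈ Icc s t, HasDerivAt Φ (Φ' x) x) (hpos : ∀ x ∈ Icc s t, 0 < Φ' x) (f : ℝ → ℝ) :
    ∫ x in Ioo s t, Φ' x * f (Φ x) = ∫ y in Ioo (Φ s) (Φ t), f y := by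
  rw [← image_Ioo_of_forall_hasDerivAt_pos hst hd hpos,
    integral_image_eq_integral_abs_deriv_smul measurableSet_Ioo
      (fun x hx ↦ (hd x (Ioo_subset_Icc_self hx)).hasDerivWithinAt)
      ((strictMonoOn_of_forall_hasDerivAt_pos hd hpos).injOn.mono Ioo_subset_Icc_self)]
  refine setIntegral_congr_fun measurableSet_Ioo fun x hx ↦ ?_
  rw [abs_of_pos (hpos x (Ioo_subset_Icc_self hx)), smul_eq_mul]

theorem integrableOn_deriv_mul_comp_sub_left (hst : s ≤ t)
    (hd : ∀ x ∈ Icc s t, HasDerivAt Φ (Φ' x) x) (hpos : ∀ x ∈ Icc s t, 0 < Φ' x) {f : ℝ → ℝ}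
    (hf : IntegrableOn f (Ioo 0 (Φ t - Φ s))) :
    IntegrableOn (fun x ↦ Φ' x * f (Φ t - Φ x)) (Ioo s t) := by
  refine (integrableOn_deriv_mul_comp_iff hst hd hpos fun y ↦ f (Φ t - y)).2 ?_
  have hle : Φ s ≤ Φ t := (strictMonoOn_of_forall_hasDerivAt_pos hd hpos).monotoneOn
    (left_mem_Icc.2 hst) (right_mem_Icc.2 hst) hst
  rw [← intervalIntegrable_iff_integrableOn_Ioo_of_le (sub_nonneg.2 hle)] at hf
  rw [← intervalIntegrable_iff_integrableOn_Ioo_of_le hle]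
  simpa using (hf.comp_sub_left (Φ t)).symm

variable {μ κ ω : ℝ}

theorem integrableOn_deriv_mul_mittagLefflerKernel (hst : s ≤ t)
    (hd : ∀ x ∈ Icc s t, HasDerivAt Φ (Φ' x) x) (hpos : ∀ x ∈ Icc s t, 0 < Φ' x) {p q : ℝ}
    (hp : 0 < p) (hq : 0 < q) (c : ℝ) :
    IntegrableOn (fun x ↦ Φ' x * mittagLefflerKernel p q c (Φ t - Φ x)) (Ioo s t) :=
  integrableOn_deriv_mul_comp_sub_left hst hd hpos (integrableOn_mittagLefflerKernel hp hq c _)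

theorem integrableOn_rpow_sub_mul (hst : s ≤ t)
    (hd : ∀ x ∈ Icc s t, HasDerivAt Φ (Φ' x) x) (hc : ContinuousOn Φ' (Icc s t))
    (hpos : ∀ x ∈ Icc s t, 0 < Φ' x) {r : ℝ} (hr : -1 < r) {w : ℝ → ℝ}
    (hw : ContinuousOn w (Icc s t)) :
    IntegrableOn (fun x ↦ (Φ t - Φ x) ^ r * w x) (Ioo s t) := by
  have hle : Φ s ≤ Φ t := (strictMonoOn_of_forall_hasDerivAt_pos hd hpos).monotoneOn
    (left_mem_Icc.2 hst) (right_mem_Icc.2 hst) hst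
  have h := integrableOn_deriv_mul_comp_sub_left hst hd hpos (f := fun y ↦ y ^ r)
    ((intervalIntegrable_iff_integrableOn_Ioo_of_le (sub_nonneg.2 hle)).1
      (intervalIntegral.intervalIntegrable_rpow' hr))
  rw [← integrableOn_Icc_iff_integrableOn_Ioo] at h ⊢
  refine (h.mul_continuousOn (hw.div hc fun x hx ↦ (hpos x hx).ne') isCompact_Icc).congr_fun
    (fun x hx ↦ ?_) measurableSet_Icc
  have := (hpos x hx).ne'
  simp only [Pi.div_apply]
  field_simp

/-- The operator `D^μ + ω D^κ` as an integral against the memory kernel. -/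
theorem caputo_add_caputo_eq_setIntegral (hst : s ≤ t)
    (hd : ∀ x ∈ Icc s t, HasDerivAt Φ (Φ' x) x) (hc : ContinuousOn Φ' (Icc s t))
    (hpos : ∀ x ∈ Icc s t, 0 < Φ' x) (hκ : κ < 1) (hμ : μ < 1) {w : ℝ → ℝ}
    (hw : ContinuousOn w (Icc s t)) :
    (1 / Real.Gamma (1 - μ)) * (∫ x in s..t, (Φ t - Φ x) ^ (-μ) * w x)
        + ω * ((1 / Real.Gamma (1 - κ)) * ∫ x in s..t, (Φ t - Φ x) ^ (-κ) * w x) =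
      ∫ x in Ioo s t, memoryKernel μ κ ω (Φ t - Φ x) * w x := by
  have h1 := integrableOn_rpow_sub_mul hst hd hc hpos (neg_lt_neg hμ) hw
  have h2 := integrableOn_rpow_sub_mul hst hd hc hpos (neg_lt_neg hκ) hw
  have e (x : ℝ) : memoryKernel μ κ ω (Φ t - Φ x) * w x =
      1 / Real.Gamma (1 - μ) * ((Φ t - Φ x) ^ (-μ) * w x) +
        ω * (1 / Real.Gamma (1 - κ)) * ((Φ t - Φ x) ^ (-κ) * w x) := by
    rw [memoryKernel]
    ring
  simp_rw [e]
  rw [integral_add (h1.const_mul _) (h2.const_mul _), integral_const_mul, integral_const_mul,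
    intervalIntegral.integral_of_le hst, intervalIntegral.integral_of_le hst,
    integral_Ioc_eq_integral_Ioo, integral_Ioc_eq_integral_Ioo, mul_assoc ω]

theorem measurable_memoryKernel : Measurable (memoryKernel μ κ ω) := by
  unfold memoryKernel
  fun_prop

theorem integrableOn_deriv_mul_sonine (hst : s < t)
    (hd : ∀ x ∈ Icc s t, HasDerivAt Φ (Φ' x) x) (hpos : ∀ x ∈ Icc s t, 0 < Φ' x)
    (hκ : 0 < κ) (hκμ : κ < μ) (hμ : μ < 1) (ω : ℝ) :
    IntegrableOn (fun x ↦ Φ' x * mittagLefflerKernel (μ - κ) μ (-ω) (Φ t - Φ x) *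
      memoryKernel μ κ ω (Φ x - Φ s)) (Ioo s t) := by
  have hlt : Φ s < Φ t := strictMonoOn_of_forall_hasDerivAt_pos hd hpos
    (left_mem_Icc.2 hst.le) (right_mem_Icc.2 hst.le) hst
  have h := integrableOn_mittagLefflerKernel_mul_memoryKernel hκ hκμ hμ ω (sub_pos.2 hlt)
  rw [← sub_self (Φ s), ← integrableOn_deriv_mul_comp_iff (Φ := fun x ↦ Φ x - Φ s) hst.le
    (fun x hx ↦ (hd x hx).sub_const _) hpos] at h
  simpa only [sub_sub_sub_cancel_right, mul_assoc] using h

theorem setIntegral_deriv_mul_sonine (hst : s < t)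
    (hd : ∀ x ∈ Icc s t, HasDerivAt Φ (Φ' x) x) (hpos : ∀ x ∈ Icc s t, 0 < Φ' x)
    (hκ : 0 < κ) (hκμ : κ < μ) (hμ : μ < 1) (ω : ℝ) :
    ∫ x in Ioo s t, Φ' x * mittagLefflerKernel (μ - κ) μ (-ω) (Φ t - Φ x) *
      memoryKernel μ κ ω (Φ x - Φ s) = 1 := by
  have hlt : Φ s < Φ t := strictMonoOn_of_forall_hasDerivAt_pos hd hpos
    (left_mem_Icc.2 hst.le) (right_mem_Icc.2 hst.le) hst
  have h := setIntegral_mittagLefflerKernel_mul_memoryKernel hκ hκμ hμ ω (sub_pos.2 hlt)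
  rw [← sub_self (Φ s), ← setIntegral_deriv_mul_comp (Φ := fun x ↦ Φ x - Φ s) hst.le
    (fun x hx ↦ (hd x hx).sub_const _) hpos] at h
  simpa only [sub_sub_sub_cancel_right, mul_assoc] using h

/-- Applying the Mittag-Leffler kernel to `(D^μ + ω D^κ) z` recovers the increment of `z`. -/
theorem setIntegral_mittagLefflerKernel_mul_caputo (hst : s ≤ t)
    (hd : ∀ x ∈ Icc s t, HasDerivAt Φ (Φ' x) x) (hc : ContinuousOn Φ' (Icc s t))
    (hpos : ∀ x ∈ Icc s t, 0 < Φ' x) (hκ : 0 < κ) (hκμ : κ < μ) (hμ : μ < 1) (hω : 0 ≤ ω)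
    {z z' : ℝ → ℝ} (hz : ∀ x ∈ Icc s t, HasDerivAt z (z' x) x) (hz' : ContinuousOn z' (Icc s t)) :
    IntegrableOn (fun x ↦ Φ' x * mittagLefflerKernel (μ - κ) μ (-ω) (Φ t - Φ x) *
        ∫ y in Ioo s x, memoryKernel μ κ ω (Φ x - Φ y) * z' y) (Ioo s t) ∧
      ∫ x in Ioo s t, Φ' x * mittagLefflerKernel (μ - κ) μ (-ω) (Φ t - Φ x) *
        ∫ y in Ioo s x, memoryKernel μ κ ω (Φ x - Φ y) * z' y = z t - z s := by
  have hα := sub_pos.2 hκμ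
  have hμ0 := hκ.trans hκμ
  have hκ1 := hκμ.trans hμ
  have hsm := strictMonoOn_of_forall_hasDerivAt_pos hd hpos
  set k := mittagLefflerKernel (μ - κ) μ (-ω) with hk
  set G := memoryKernel μ κ ω with hG
  set ν := volume.restrict (Ioo s t) with hν
  set f : ℝ → ℝ → ℝ := fun x y ↦ Φ' x * k (Φ t - Φ x) * G (Φ x - Φ y) * z' y with hf
  set H : ℝ × ℝ → ℝ := {p | p.2 < p.1}.indicator (fun p ↦ f p.1 p.2) with hH
  have hH1 (x y : ℝ) : H (x, y) = (Ioi y).indicator (fun x ↦ f x y) x := rfl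
  have hH2 (x y : ℝ) : H (x, y) = (Iio x).indicator (fun y ↦ f x y) y := rfl
  have hsub : Ioo s t ⊆ Icc s t := Ioo_subset_Icc_self
  have aem {u : ℝ → ℝ} (hu : ContinuousOn u (Icc s t)) : AEMeasurable u ν :=
    (hu.mono hsub).aemeasurable measurableSet_Ioo
  have hΦm : AEMeasurable Φ ν := aem fun x hx ↦ (hd x hx).continuousAt.continuousWithinAt
  have hkm : Measurable k := measurable_mittagLefflerKernel hα hμ0 _
  have hGm : Measurable G := measurable_memoryKernel
  have hHm : AEStronglyMeasurable H (ν.prod ν) := by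
    refine AEStronglyMeasurable.indicator (AEMeasurable.aestronglyMeasurable ?_)
      (measurableSet_lt measurable_snd measurable_fst)
    have h1 := hΦm.comp_quasiMeasurePreserving
      (Measure.quasiMeasurePreserving_fst (μ := ν) (ν := ν))
    have h2 := hΦm.comp_quasiMeasurePreserving
      (Measure.quasiMeasurePreserving_snd (μ := ν) (ν := ν))
    have h3 := (aem hc).comp_quasiMeasurePreserving
      (Measure.quasiMeasurePreserving_fst (μ := ν) (ν := ν))
    have h4 := (aem hz').comp_quasiMeasurePreserving
      (Measure.quasiMeasurePreserving_snd (μ := ν) (ν := ν))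
    exact ((h3.mul (hkm.comp_aemeasurable (h1.const_sub _))).mul
      (hGm.comp_aemeasurable (h1.sub h2))).mul h4
  have hinter {y : ℝ} (hy : y ∈ Ioo s t) : Ioo s t ∩ Ioi y = Ioo y t := by
    rw [Ioo_inter_Ioi, max_eq_right hy.1.le]
  have hinter' {x : ℝ} (hx : x ∈ Ioo s t) : Ioo s t ∩ Iio x = Ioo s x := by
    rw [Ioo_inter_Iio, min_eq_right hx.2.le]
  have hsubI {y : ℝ} (hy : y ∈ Ioo s t) : Icc y t ⊆ Icc s t := Icc_subset_Icc_left hy.1.le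
  have hnn {y x : ℝ} (hy : y ∈ Ioo s t) (hx : x ∈ Ioo y t) :
      0 ≤ Φ' x * k (Φ t - Φ x) * G (Φ x - Φ y) := by
    have hxI : x ∈ Icc s t := hsubI hy (Ioo_subset_Icc_self hx)
    refine mul_nonneg (mul_nonneg (hpos x hxI).le (mittagLefflerKernel_pos hκ hκμ hμ hω
      (sub_pos.2 (hsm hxI (right_mem_Icc.2 hst) hx.2))).le) (memoryKernel_nonneg hκ1 hμ hω
      (sub_nonneg.2 (hsm (hsub hy) hxI hx.1).le))
  have hsec {y : ℝ} (hy : y ∈ Ioo s t) : IntegrableOn (fun x ↦ f x y) (Ioo y t) :=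
    (integrableOn_deriv_mul_sonine hy.2 (fun x hx ↦ hd x (hsubI hy hx))
      (fun x hx ↦ hpos x (hsubI hy hx)) hκ hκμ hμ ω).mul_const (z' y)
  have hone {y : ℝ} (hy : y ∈ Ioo s t) :
      ∫ x in Ioo y t, Φ' x * k (Φ t - Φ x) * G (Φ x - Φ y) = 1 :=
    setIntegral_deriv_mul_sonine hy.2 (fun x hx ↦ hd x (hsubI hy hx))
      (fun x hx ↦ hpos x (hsubI hy hx)) hκ hκμ hμ ω
  have hz'int : IntegrableOn z' (Ioo s t) :=
    (hz'.integrableOn_compact isCompact_Icc).mono_set hsub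
  have hHint : Integrable H (ν.prod ν) := by
    refine (integrable_prod_iff' hHm).2 ⟨?_, ?_⟩
    · filter_upwards [ae_restrict_mem measurableSet_Ioo] with y hy
      simp_rw [hH1]
      rw [integrable_indicator_iff measurableSet_Ioi, IntegrableOn, hν,
        Measure.restrict_restrict measurableSet_Ioi, inter_comm, hinter hy]
      exact hsec hy
    · refine hz'int.norm.congr ?_
      filter_upwards [ae_restrict_mem measurableSet_Ioo] with y hy
      simp_rw [hH1, norm_indicator_eq_indicator_norm]
      rw [hν, setIntegral_indicator measurableSet_Ioi, hinter hy]
      have e : ∀ x ∈ Ioo y t, ‖f x y‖ = Φ' x * k (Φ t - Φ x) * G (Φ x - Φ y) * ‖z' y‖ := by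
        intro x hx
        rw [hf, norm_mul, Real.norm_of_nonneg (hnn hy hx)]
      rw [setIntegral_congr_fun measurableSet_Ioo e, integral_mul_const, hone hy, one_mul]
  have hinner {x : ℝ} (hx : x ∈ Ioo s t) : ∫ y, H (x, y) ∂ν =
      Φ' x * k (Φ t - Φ x) * ∫ y in Ioo s x, G (Φ x - Φ y) * z' y := by
    simp_rw [hH2]
    rw [hν, setIntegral_indicator measurableSet_Iio, hinter' hx, ← integral_const_mul]
    simp_rw [hf, mul_assoc]
  have hswap := integral_integral_swap (f := fun x y ↦ H (x, y)) hHint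
  refine ⟨hHint.integral_prod_left.congr ?_, ?_⟩
  · filter_upwards [ae_restrict_mem measurableSet_Ioo] with x hx using hinner hx
  · rw [← setIntegral_congr_fun measurableSet_Ioo fun x hx ↦ hinner hx]
    rw [← hν, hswap]
    have e : ∀ y ∈ Ioo s t, ∫ x, H (x, y) ∂ν = z' y := by
      intro y hy
      simp_rw [hH1]
      rw [hν, setIntegral_indicator measurableSet_Ioi, hinter hy, hf, integral_mul_const, hone hy,
        one_mul]
    rw [hν, setIntegral_congr_fun measurableSet_Ioo e, ← integral_Ioc_eq_integral_Ioo,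
      ← intervalIntegral.integral_of_le hst]
    refine intervalIntegral.integral_eq_sub_of_hasDerivAt (fun x hx ↦ hz x ?_) ?_
    · rwa [uIcc_of_le hst] at hx
    · exact ContinuousOn.intervalIntegrable (by rwa [uIcc_of_le hst])

end ChangeOfVariables

section SolutionOperator

variable {a b : ℝ} {Φ Φ' : ℝ → ℝ} {F : ℝ → ℝ → ℝ}

theorem aemeasurable_comp_of_continuousOn_prod (hab : a ≤ b)
    (hFc : ContinuousOn (fun p : ℝ × ℝ ↦ F p.1 p.2) (Icc a b ×ˢ (univ : Set ℝ))) {y : ℝ → ℝ}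
    (hy : AEMeasurable y (volume.restrict (Icc a b))) :
    AEMeasurable (fun ρ ↦ F ρ (y ρ)) (volume.restrict (Icc a b)) := by
  have hc : Continuous fun p : ℝ × ℝ ↦ F (projIcc a b hab p.1) p.2 :=
    hFc.comp_continuous (f := fun p : ℝ × ℝ ↦ ((projIcc a b hab p.1 : ℝ), p.2)) (by fun_prop)
      fun p ↦ ⟨(projIcc a b hab p.1).2, mem_univ _⟩
  refine (hc.measurable.comp_aemeasurable (aemeasurable_id.prodMk hy)).congr ?_
  filter_upwards [ae_restrict_mem measurableSet_Icc] with ρ hρ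
  simp [projIcc_of_mem hab hρ]

theorem exists_bound_comp_of_mem_Icc
    (hFc : ContinuousOn (fun p : ℝ × ℝ ↦ F p.1 p.2) (Icc a b ×ˢ (univ : Set ℝ)))
    {l u : ℝ → ℝ} (hl : ContinuousOn l (Icc a b)) (hu : ContinuousOn u (Icc a b)) :
    ∃ C, ∀ y : ℝ → ℝ, (∀ ρ ∈ Icc a b, l ρ ≤ y ρ ∧ y ρ ≤ u ρ) →
      ∀ ρ ∈ Icc a b, ‖F ρ (y ρ)‖ ≤ C := by
  obtain ⟨m, hm⟩ := isCompact_Icc.bddBelow_image hl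
  obtain ⟨M, hM⟩ := isCompact_Icc.bddAbove_image hu
  obtain ⟨C, hC⟩ :=
    (isCompact_Icc.prod (isCompact_Icc (a := m) (b := M))).exists_bound_of_continuousOn
    (hFc.mono (prod_mono_right (subset_univ _)))
  exact ⟨C, fun y hy ρ hρ ↦ hC (ρ, y ρ) ⟨hρ, (hm (mem_image_of_mem l hρ)).trans (hy ρ hρ).1,
    (hy ρ hρ).2.trans (hM (mem_image_of_mem u hρ))⟩⟩

theorem integrableOn_mittagLefflerKernel_mul_comp (hab : a ≤ b)
    (hd : ∀ x ∈ Icc a b, HasDerivAt Φ (Φ' x) x) (hpos : ∀ x ∈ Icc a b, 0 < Φ' x)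
    (hFc : ContinuousOn (fun p : ℝ × ℝ ↦ F p.1 p.2) (Icc a b ×ˢ (univ : Set ℝ)))
    {l u y : ℝ → ℝ} (hl : ContinuousOn l (Icc a b)) (hu : ContinuousOn u (Icc a b))
    (hy : AEMeasurable y (volume.restrict (Icc a b)))
    (hly : ∀ ρ ∈ Icc a b, l ρ ≤ y ρ ∧ y ρ ≤ u ρ) {p q : ℝ} (hp : 0 < p) (hq : 0 < q) (c : ℝ)
    {t : ℝ} (ht : t ∈ Icc a b) :
    IntegrableOn (fun ρ ↦ Φ' ρ * mittagLefflerKernel p q c (Φ t - Φ ρ) * F ρ (y ρ))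
      (Ioo a t) := by
  obtain ⟨C, hC⟩ := exists_bound_comp_of_mem_Icc hFc hl hu
  have hsub : Icc a t ⊆ Icc a b := Icc_subset_Icc_right ht.2
  have hK := integrableOn_deriv_mul_mittagLefflerKernel ht.1 (fun x hx ↦ hd x (hsub hx))
    (fun x hx ↦ hpos x (hsub hx)) hp hq c
  refine hK.mul_bdd (c := C) ((aemeasurable_comp_of_continuousOn_prod hab hFc hy).mono_measure
    (Measure.restrict_mono (Ioo_subset_Icc_self.trans hsub) le_rfl)).aestronglyMeasurable ?_
  filter_upwards [ae_restrict_mem measurableSet_Ioo] with ρ hρ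
  exact hC y hly ρ (hsub (Ioo_subset_Icc_self hρ))

theorem aemeasurable_setIntegral_mittagLefflerKernel_mul_comp
    (hd : ∀ x ∈ Icc a b, HasDerivAt Φ (Φ' x) x) (hc : ContinuousOn Φ' (Icc a b))
    {g : ℝ → ℝ} (hg : AEMeasurable g (volume.restrict (Icc a b)))
    {p q : ℝ} (hp : 0 < p) (hq : 0 < q) (c : ℝ) :
    AEMeasurable (fun t ↦ ∫ ρ in Ioo a t, Φ' ρ * mittagLefflerKernel p q c (Φ t - Φ ρ) * g ρ)
      (volume.restrict (Icc a b)) := by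
  set ν := volume.restrict (Icc a b) with hν
  set f : ℝ → ℝ → ℝ := fun t ρ ↦ Φ' ρ * mittagLefflerKernel p q c (Φ t - Φ ρ) * g ρ with hf
  have hΦm : AEMeasurable Φ ν := ContinuousOn.aemeasurable
    (fun x hx ↦ (hd x hx).continuousAt.continuousWithinAt) measurableSet_Icc
  have hH : AEStronglyMeasurable
      ({p | p.2 ∈ Ioo a p.1}.indicator fun p : ℝ × ℝ ↦ f p.1 p.2) (ν.prod ν) := by
    refine AEStronglyMeasurable.indicator (AEMeasurable.aestronglyMeasurable ?_)
      ((measurableSet_lt measurable_const measurable_snd).inter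
        (measurableSet_lt measurable_snd measurable_fst))
    have h1 := hΦm.comp_quasiMeasurePreserving
      (Measure.quasiMeasurePreserving_fst (μ := ν) (ν := ν))
    have h2 := hΦm.comp_quasiMeasurePreserving
      (Measure.quasiMeasurePreserving_snd (μ := ν) (ν := ν))
    have h3 := (hc.aemeasurable measurableSet_Icc).comp_quasiMeasurePreserving
      (Measure.quasiMeasurePreserving_snd (μ := ν) (ν := ν))
    have h4 := hg.comp_quasiMeasurePreserving
      (Measure.quasiMeasurePreserving_snd (μ := ν) (ν := ν))
    exact (h3.mul ((measurable_mittagLefflerKernel hp hq c).comp_aemeasurable (h1.sub h2))).mul h4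
  refine hH.integral_prod_right'.aemeasurable.congr ?_
  filter_upwards [ae_restrict_mem measurableSet_Icc] with t ht
  change ∫ ρ in Icc a b, (Ioo a t).indicator (fun ρ ↦ f t ρ) ρ = _
  rw [setIntegral_indicator measurableSet_Ioo,
    inter_eq_right.2 (Ioo_subset_Icc_self.trans (Icc_subset_Icc_right ht.2))]

/-- A positive kernel preserves order. -/
theorem setIntegral_mittagLefflerKernel_mono {κ μ ω t : ℝ}
    (hd : ∀ x ∈ Icc a t, HasDerivAt Φ (Φ' x) x) (hpos : ∀ x ∈ Icc a t, 0 < Φ' x)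
    (hκ : 0 < κ) (hκμ : κ < μ) (hμ : μ < 1) (hω : 0 ≤ ω) (hat : a ≤ t) {f g : ℝ → ℝ}
    (hf : IntegrableOn
      (fun ρ ↦ Φ' ρ * mittagLefflerKernel (μ - κ) μ (-ω) (Φ t - Φ ρ) * f ρ) (Ioo a t))
    (hg : IntegrableOn
      (fun ρ ↦ Φ' ρ * mittagLefflerKernel (μ - κ) μ (-ω) (Φ t - Φ ρ) * g ρ) (Ioo a t))
    (hfg : ∀ ρ ∈ Icc a t, f ρ ≤ g ρ) :
    ∫ ρ in Ioo a t, Φ' ρ * mittagLefflerKernel (μ - κ) μ (-ω) (Φ t - Φ ρ) * f ρ ≤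
      ∫ ρ in Ioo a t, Φ' ρ * mittagLefflerKernel (μ - κ) μ (-ω) (Φ t - Φ ρ) * g ρ := by
  refine setIntegral_mono_on hf hg measurableSet_Ioo fun ρ hρ ↦ ?_
  have hρ' := Ioo_subset_Icc_self hρ
  exact mul_le_mul_of_nonneg_left (hfg ρ hρ') (mul_nonneg (hpos ρ hρ').le
    (mittagLefflerKernel_pos hκ hκμ hμ hω (sub_pos.2
      (strictMonoOn_of_forall_hasDerivAt_pos hd hpos hρ' (right_mem_Icc.2 hat) hρ.2))).le)

end SolutionOperator

/-- Monotonicity of the iterates: starting from a lower solution `z₀`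
and an upper solution `z̃₀` with `z₀ ≤ z̃₀` and `F(ℓ,·)` nondecreasing in the sector,
the recursively defined iterates satisfy
`z_n(ℓ) ≤ z_{n+1}(ℓ) ≤ z̃_{n+1}(ℓ) ≤ z̃_n(ℓ)` for every `n` and `ℓ ∈ [a,b]`. -/
theorem monotone_iterates
    (a b : ℝ) (hab : a < b)
    (Φ Φ' : ℝ → ℝ)
    (hΦd : ∀ x ∈ Icc a b, HasDerivAt Φ (Φ' x) x)
    (hΦ'c : ContinuousOn Φ' (Icc a b))
    (hΦ'pos : ∀ x ∈ Icc a b, 0 < Φ' x)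
    (μ κ ω za : ℝ) (hκ0 : 0 < κ) (hκμ : κ < μ) (hμ1 : μ < 1) (hω : 0 < ω)
    (F : ℝ → ℝ → ℝ)
    (hFc : ContinuousOn (fun p : ℝ × ℝ => F p.1 p.2) (Icc a b ×ˢ (univ : Set ℝ)))
    -- z₀ is a lower solution:
    (z₀ z₀' : ℝ → ℝ)
    (hz₀d : ∀ x ∈ Icc a b, HasDerivAt z₀ (z₀' x) x)
    (hz₀'c : ContinuousOn z₀' (Icc a b))
    (hlow : ∀ ℓ ∈ Icc a b,
      (1 / Real.Gamma (1 - μ)) * (∫ ρ in a..ℓ, (Φ ℓ - Φ ρ) ^ (-μ) * z₀' ρ)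
        + ω * ((1 / Real.Gamma (1 - κ)) * ∫ ρ in a..ℓ, (Φ ℓ - Φ ρ) ^ (-κ) * z₀' ρ)
      ≤ F ℓ (z₀ ℓ))
    (hlowa : z₀ a ≤ za)
    -- z̃₀ is an upper solution:
    (zt₀ zt₀' : ℝ → ℝ)
    (hzt₀d : ∀ x ∈ Icc a b, HasDerivAt zt₀ (zt₀' x) x)
    (hzt₀'c : ContinuousOn zt₀' (Icc a b))
    (hup : ∀ ℓ ∈ Icc a b,
      F ℓ (zt₀ ℓ) ≤
        (1 / Real.Gamma (1 - μ)) * (∫ ρ in a..ℓ, (Φ ℓ - Φ ρ) ^ (-μ) * zt₀' ρ)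
          + ω * ((1 / Real.Gamma (1 - κ)) * ∫ ρ in a..ℓ, (Φ ℓ - Φ ρ) ^ (-κ) * zt₀' ρ))
    (hupa : za ≤ zt₀ a)
    -- ordering of lower and upper solutions and monotonicity of F in the sector:
    (hord : ∀ ℓ ∈ Icc a b, z₀ ℓ ≤ zt₀ ℓ)
    (hFmono : ∀ ℓ ∈ Icc a b, ∀ x y : ℝ,
      z₀ ℓ ≤ x → x ≤ y → y ≤ zt₀ ℓ → F ℓ x ≤ F ℓ y)
    -- the recursively defined iterates:
    (zseq ztseq : ℕ → ℝ → ℝ)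
    (hzseq0 : zseq 0 = z₀) (hztseq0 : ztseq 0 = zt₀)
    (hzrec : ∀ n : ℕ, ∀ ℓ ∈ Icc a b,
      zseq (n + 1) ℓ = za + ∫ ρ in a..ℓ,
        Φ' ρ * (Φ ℓ - Φ ρ) ^ (μ - 1) *
          mittagLeffler (μ - κ) μ (-ω * (Φ ℓ - Φ ρ) ^ (μ - κ)) * F ρ (zseq n ρ))
    (hztrec : ∀ n : ℕ, ∀ ℓ ∈ Icc a b,
      ztseq (n + 1) ℓ = za + ∫ ρ in a..ℓ,
        Φ' ρ * (Φ ℓ - Φ ρ) ^ (μ - 1) *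
          mittagLeffler (μ - κ) μ (-ω * (Φ ℓ - Φ ρ) ^ (μ - κ)) * F ρ (ztseq n ρ)) :
    ∀ n : ℕ, ∀ ℓ ∈ Icc a b,
      zseq n ℓ ≤ zseq (n + 1) ℓ ∧ zseq (n + 1) ℓ ≤ ztseq (n + 1) ℓ ∧
        ztseq (n + 1) ℓ ≤ ztseq n ℓ := by
  have hα := sub_pos.2 hκμ
  have hμ0 := hκ0.trans hκμ
  have hκ1 := hκμ.trans hμ1
  have hsub {t : ℝ} (ht : t ∈ Icc a b) : Icc a t ⊆ Icc a b := Icc_subset_Icc_right ht.2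
  have hz₀c : ContinuousOn z₀ (Icc a b) := fun x hx ↦
    (hz₀d x hx).continuousAt.continuousWithinAt
  have hzt₀c : ContinuousOn zt₀ (Icc a b) := fun x hx ↦
    (hzt₀d x hx).continuousAt.continuousWithinAt
  set K : ℝ → ℝ → ℝ := fun t ρ ↦ Φ' ρ * mittagLefflerKernel (μ - κ) μ (-ω) (Φ t - Φ ρ) with hK
  set T : (ℝ → ℝ) → ℝ → ℝ := fun y t ↦ za + ∫ ρ in Ioo a t, K t ρ * F ρ (y ρ) with hT
  have hrec (w : ℕ → ℝ → ℝ) (hw : ∀ n : ℕ, ∀ ℓ ∈ Icc a b, w (n + 1) ℓ = za + ∫ ρ in a..ℓ,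
      Φ' ρ * (Φ ℓ - Φ ρ) ^ (μ - 1) *
        mittagLeffler (μ - κ) μ (-ω * (Φ ℓ - Φ ρ) ^ (μ - κ)) * F ρ (w n ρ))
      (n : ℕ) (t : ℝ) (ht : t ∈ Icc a b) : w (n + 1) t = T (w n) t := by
    rw [hw n t ht, intervalIntegral.integral_of_le ht.1, integral_Ioc_eq_integral_Ioo]
    simp only [hT, hK, mittagLefflerKernel, mul_assoc]
  -- the functions lying in the sector
  let S : (ℝ → ℝ) → Prop := fun y ↦ AEMeasurable y (volume.restrict (Icc a b)) ∧
    ∀ ρ ∈ Icc a b, z₀ ρ ≤ y ρ ∧ y ρ ≤ zt₀ ρ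
  have hSint {y : ℝ → ℝ} (hy : S y) {t : ℝ} (ht : t ∈ Icc a b) :
      IntegrableOn (fun ρ ↦ K t ρ * F ρ (y ρ)) (Ioo a t) :=
    integrableOn_mittagLefflerKernel_mul_comp hab.le hΦd hΦ'pos hFc hz₀c hzt₀c hy.1 hy.2
      hα hμ0 _ ht
  have hmono {f g : ℝ → ℝ} {t : ℝ} (ht : t ∈ Icc a b)
      (hf : IntegrableOn (fun ρ ↦ K t ρ * f ρ) (Ioo a t))
      (hg : IntegrableOn (fun ρ ↦ K t ρ * g ρ) (Ioo a t)) (hfg : ∀ ρ ∈ Icc a b, f ρ ≤ g ρ) :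
      ∫ ρ in Ioo a t, K t ρ * f ρ ≤ ∫ ρ in Ioo a t, K t ρ * g ρ :=
    setIntegral_mittagLefflerKernel_mono (fun x hx ↦ hΦd x (hsub ht hx))
      (fun x hx ↦ hΦ'pos x (hsub ht hx)) hκ0 hκμ hμ1 hω.le ht.1 hf hg
      fun ρ hρ ↦ hfg ρ (hsub ht hρ)
  have hTmono {y w : ℝ → ℝ} (hy : S y) (hw : S w) (hyw : ∀ ρ ∈ Icc a b, y ρ ≤ w ρ) :
      ∀ t ∈ Icc a b, T y t ≤ T w t := fun t ht ↦
    add_le_add_right (hmono ht (hSint hy ht) (hSint hw ht) fun ρ hρ ↦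
      hFmono ρ hρ _ _ (hy.2 ρ hρ).1 (hyw ρ hρ) (hw.2 ρ hρ).2) za
  have hTmeas {y : ℝ → ℝ} (hy : S y) : AEMeasurable (T y) (volume.restrict (Icc a b)) :=
    (aemeasurable_setIntegral_mittagLefflerKernel_mul_comp hΦd hΦ'c
      (aemeasurable_comp_of_continuousOn_prod hab.le hFc hy.1) hα hμ0 _).const_add za
  -- the operator `D^μ + ω D^κ` and its inversion
  let D : (ℝ → ℝ) → ℝ → ℝ := fun w t ↦ ∫ x in Ioo a t, memoryKernel μ κ ω (Φ t - Φ x) * w x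
  have hD {w : ℝ → ℝ} (hw : ContinuousOn w (Icc a b)) {t : ℝ} (ht : t ∈ Icc a b) :=
    caputo_add_caputo_eq_setIntegral (ω := ω) ht.1 (fun x hx ↦ hΦd x (hsub ht hx))
      (hΦ'c.mono (hsub ht)) (fun x hx ↦ hΦ'pos x (hsub ht hx)) hκ1 hμ1 (hw.mono (hsub ht))
  have hinv {z z' : ℝ → ℝ} (hz : ∀ x ∈ Icc a b, HasDerivAt z (z' x) x)
      (hz' : ContinuousOn z' (Icc a b)) {t : ℝ} (ht : t ∈ Icc a b) :
      IntegrableOn (fun ρ ↦ K t ρ * D z' ρ) (Ioo a t) ∧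
        ∫ ρ in Ioo a t, K t ρ * D z' ρ = z t - z a :=
    setIntegral_mittagLefflerKernel_mul_caputo ht.1 (fun x hx ↦ hΦd x (hsub ht hx))
      (hΦ'c.mono (hsub ht)) (fun x hx ↦ hΦ'pos x (hsub ht hx)) hκ0 hκμ hμ1 hω.le
      (fun x hx ↦ hz x (hsub ht hx)) (hz'.mono (hsub ht))
  have hS₀ : S z₀ := ⟨hz₀c.aemeasurable measurableSet_Icc, fun ρ hρ ↦ ⟨le_rfl, hord ρ hρ⟩⟩
  have hSt₀ : S zt₀ := ⟨hzt₀c.aemeasurable measurableSet_Icc, fun ρ hρ ↦ ⟨hord ρ hρ, le_rfl⟩⟩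
  have hz₀T : ∀ t ∈ Icc a b, z₀ t ≤ T z₀ t := fun t ht ↦ by
    obtain ⟨hi, he⟩ := hinv hz₀d hz₀'c ht
    have := hmono ht hi (hSint hS₀ ht) fun ρ hρ ↦ (hD hz₀'c hρ).symm.le.trans (hlow ρ hρ)
    simp only [hT]
    linarith
  have hTzt₀ : ∀ t ∈ Icc a b, T zt₀ t ≤ zt₀ t := fun t ht ↦ by
    obtain ⟨hi, he⟩ := hinv hzt₀d hzt₀'c ht
    have := hmono ht (hSint hSt₀ ht) hi fun ρ hρ ↦ (hup ρ hρ).trans (hD hzt₀'c hρ).le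
    simp only [hT]
    linarith
  have hST {y : ℝ → ℝ} (hy : S y) : S (T y) := ⟨hTmeas hy, fun t ht ↦
    ⟨(hz₀T t ht).trans (hTmono hS₀ hy (fun ρ hρ ↦ (hy.2 ρ hρ).1) t ht),
      (hTmono hy hSt₀ (fun ρ hρ ↦ (hy.2 ρ hρ).2) t ht).trans (hTzt₀ t ht)⟩⟩
  have hScongr {y w : ℝ → ℝ} (hy : S y) (hyw : ∀ t ∈ Icc a b, w t = y t) : S w :=
    ⟨hy.1.congr ((ae_restrict_mem measurableSet_Icc).mono fun t ht ↦ (hyw t ht).symm),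
      fun t ht ↦ by rw [hyw t ht]; exact hy.2 t ht⟩
  have hSz (n : ℕ) : S (zseq n) := by
    induction n with
    | zero => rwa [hzseq0]
    | succ n ih => exact hScongr (hST ih) (hrec zseq hzrec n)
  have hSzt (n : ℕ) : S (ztseq n) := by
    induction n with
    | zero => rwa [hztseq0]
    | succ n ih => exact hScongr (hST ih) (hrec ztseq hztrec n)
  have hle (n : ℕ) : ∀ t ∈ Icc a b, zseq n t ≤ ztseq n t := by
    induction n with
    | zero => rwa [hzseq0, hztseq0]
    | succ n ih =>
      intro t ht
      rw [hrec zseq hzrec n t ht, hrec ztseq hztrec n t ht]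
      exact hTmono (hSz n) (hSzt n) ih t ht
  have hinc (n : ℕ) : ∀ t ∈ Icc a b, zseq n t ≤ zseq (n + 1) t := by
    induction n with
    | zero => exact fun t ht ↦ by rw [hrec zseq hzrec 0 t ht, hzseq0]; exact hz₀T t ht
    | succ n ih =>
      intro t ht
      rw [hrec zseq hzrec n t ht, hrec zseq hzrec (n + 1) t ht]
      exact hTmono (hSz n) (hSz (n + 1)) ih t ht
  have hdec (n : ℕ) : ∀ t ∈ Icc a b, ztseq (n + 1) t ≤ ztseq n t := by
    induction n with
    | zero => exact fun t ht ↦ by rw [hrec ztseq hztrec 0 t ht, hztseq0]; exact hTzt₀ t ht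
    | succ n ih =>
      intro t ht
      rw [hrec ztseq hztrec n t ht, hrec ztseq hztrec (n + 1) t ht]
      exact hTmono (hSzt (n + 1)) (hSzt n) ih t ht
  exact fun n t ht ↦ ⟨hinc n t ht, hle (n + 1) t ht, hdec n t ht⟩
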